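/- arXiv:2210.00730 — 2 statements merged into one kernel-verified Lean document; each statement's English description precedes it below -/
import Mathlib

section
/- Let p be a prime and let k, N be integers with 0 ≤ k < N < p. Let α, β be elements of the algebraic closure of F_p with α ≠ 0. If F_p(α^N) is a proper subfield of F_p(α^N, β^N, α^k·β^{N−1}), then there exists λ ∈ F_p(α^N) such that the cardinality of F_p((β + λ·α^k)^N) is strictly greater than the cardinality of F_p(α^N). -/
open Polynomial

/-- A simple extension of the prime field inside `AlgebraicClosure (ZMod p)` is finite. -/
theorem finite_closure_singleton (p : ℕ) [Fact p.Prime] (x : AlgebraicClosure (ZMod p)) :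
    Finite (Subfield.closure ({x} : Set (AlgebraicClosure (ZMod p)))) := by
  have hx : IsIntegral (ZMod p) x := Algebra.IsIntegral.isIntegral x
  have : FiniteDimensional (ZMod p) (IntermediateField.adjoin (ZMod p) {x}) :=
    IntermediateField.adjoin.finiteDimensional hx
  have : Finite (IntermediateField.adjoin (ZMod p) {x}) := Module.finite_of_finite (ZMod p)
  have hle : Subfield.closure {x} ≤ (IntermediateField.adjoin (ZMod p) {x}).toSubfield :=
    Subfield.closure_le.2 (IntermediateField.subset_adjoin _ _)
  exact Set.Finite.subset (Set.toFinite
    ((IntermediateField.adjoin (ZMod p) {x} : Set (AlgebraicClosure (ZMod p))))) hle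

theorem Subfield.exists_natCard_eq_pow {K : Type*} [Field K] (p : ℕ) [Fact p.Prime] [CharP K p]
    (F : Subfield K) [Finite F] : ∃ r, 1 ≤ r ∧ Nat.card F = p ^ r := by
  have := Fintype.ofFinite F
  obtain ⟨n, -, hn⟩ := FiniteField.card F p
  exact ⟨n, n.pos, by rw [Nat.card_eq_fintype_card, hn]⟩

theorem Subfield.pow_natCard {K : Type*} [Field K] (F : Subfield K) [Finite F] {x : K}
    (hx : x ∈ F) : x ^ Nat.card F = x := by
  have := Fintype.ofFinite F
  have h := FiniteField.pow_card (⟨x, hx⟩ : F)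
  rw [Nat.card_eq_fintype_card]
  exact congrArg Subtype.val h

/-- A field whose elements all satisfy `x ^ q = x` has at most `q` elements. -/
theorem natCard_le_of_pow_eq_self {K : Type*} [Field K] {q : ℕ} (hq : 1 < q) (L : Subfield K)
    (hL : ∀ x ∈ L, x ^ q = x) : Finite L ∧ Nat.card L ≤ q := by
  classical
  have hne : (X ^ q - X : K[X]) ≠ 0 := FiniteField.X_pow_card_sub_X_ne_zero K hq
  have hsub : (L : Set K) ⊆ ((X ^ q - X : K[X]).roots.toFinset : Set K) := by
    intro x hx
    simp [hne, hL x hx]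
  refine ⟨(Finset.finite_toSet _).subset hsub, ?_⟩
  calc Nat.card L = (L : Set K).ncard := rfl
    _ ≤ (X ^ q - X : K[X]).roots.toFinset.card := by
        rw [← Set.ncard_coe_finset]
        exact Set.ncard_le_ncard hsub (Finset.finite_toSet _)
    _ ≤ (X ^ q - X : K[X]).roots.card := Multiset.toFinset_card_le _
    _ ≤ (X ^ q - X : K[X]).natDegree := card_roots' _
    _ = q := FiniteField.X_pow_card_sub_X_natDegree_eq K hq

/-- At most `N * m` values `l` make `(b + l * a) ^ N` a fixed point of `x ↦ x ^ m`. -/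
theorem card_filter_affine_pow_le {K : Type*} [Field K] [DecidableEq K] {a b : K} (ha : a ≠ 0)
    {N m : ℕ} (hN : 0 < N) (hm : 1 < m) (A : Finset K) :
    (A.filter fun l => ((b + l * a) ^ N) ^ m = (b + l * a) ^ N).card ≤ N * m := by
  set u : K[X] := C a * X + C b with hu
  have hdeg : ∀ n, (u ^ n).natDegree = n := fun n => by
    rw [natDegree_pow, natDegree_linear ha, mul_one]
  have hlt : (u ^ N).natDegree < (u ^ (N * m)).natDegree := by
    rw [hdeg, hdeg]; nlinarith
  have hnd : (u ^ (N * m) - u ^ N).natDegree = N * m := by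
    rw [natDegree_sub_eq_left_of_natDegree_lt hlt, hdeg]
  have hne : u ^ (N * m) - u ^ N ≠ 0 := fun h => by
    rw [h, natDegree_zero] at hnd
    have : 0 < N * m := by positivity
    omega
  have hsub : (A.filter fun l => ((b + l * a) ^ N) ^ m = (b + l * a) ^ N) ⊆
      (u ^ (N * m) - u ^ N).roots.toFinset := by
    intro l hl
    have := (Finset.mem_filter.1 hl).2
    rw [← pow_mul] at this
    rw [Multiset.mem_toFinset, mem_roots hne, IsRoot.def]
    simp only [hu, eval_sub, eval_pow, eval_add, eval_mul, eval_C, eval_X]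
    rw [mul_comm a l, add_comm, this, sub_self]
  exact (Finset.card_le_card hsub).trans
    ((Multiset.toFinset_card_le _).trans ((card_roots' _).trans hnd.le))

/-- If two `N`-th powers of affine functions agree at more than `N` points, then their first two
coefficients agree. -/
theorem affine_pow_coeff_eq {K : Type*} [Field K] {a b a' b' : K} {N : ℕ} (hN : (N : K) ≠ 0)
    (S : Finset K) (hS : N < S.card) (h : ∀ l ∈ S, (b' + l * a') ^ N = (b + l * a) ^ N) :
    b' ^ N = b ^ N ∧ a' * b' ^ (N - 1) = a * b ^ (N - 1) := by
  have hd : ∀ a b : K, ((C a * X + C b) ^ N).natDegree ≤ N := fun a b => by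
    simpa using natDegree_pow_le_of_le N (natDegree_linear_le (a := a) (b := b))
  have heq : (C a' * X + C b') ^ N = (C a * X + C b) ^ N := by
    refine eq_of_natDegree_lt_card_of_eval_eq' _ _ S (fun l hl => ?_)
      (lt_of_le_of_lt (max_le (hd _ _) (hd _ _)) hS)
    simp only [eval_pow, eval_add, eval_mul, eval_C, eval_X]
    rw [mul_comm a', mul_comm a, add_comm _ b', add_comm _ b, h l hl]
  refine ⟨by simpa using congrArg (eval 0) heq, ?_⟩
  have h1 := congrArg (fun f => eval 0 (derivative f)) heq
  simp [derivative_pow] at h1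
  exact mul_left_cancel₀ hN (by linear_combination h1)

theorem sum_Ico_pow_mul_lt {p N r : ℕ} (hNp : N < p) (hr : 1 ≤ r) :
    N + ∑ d ∈ Finset.Ico 1 r, N * p ^ d < p ^ r := by
  induction r, hr using Nat.le_induction with
  | base => simpa using hNp
  | succ r hr ih =>
    rw [Finset.sum_Ico_succ_top hr, pow_succ]
    nlinarith [Nat.mul_le_mul_right (p ^ r) (Nat.succ_le_of_lt hNp)]


/-- The version of the theorem over any field of characteristic `p` whose simple extensions of the
prime field are finite. -/
theorem exists_natCard_closure_lt {K : Type*} [Field K] (p : ℕ) [Fact p.Prime] [CharP K p]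
    (hfin : ∀ x : K, Finite (Subfield.closure ({x} : Set K)))
    (k N : ℕ) (hkN : k < N) (hNp : N < p) (α β : K) (hα : α ≠ 0)
    (hproper : Subfield.closure ({α ^ N} : Set K) <
      Subfield.closure ({α ^ N, β ^ N, α ^ k * β ^ (N - 1)} : Set K)) :
    ∃ lam ∈ Subfield.closure ({α ^ N} : Set K),
      Nat.card (Subfield.closure ({α ^ N} : Set K)) <
        Nat.card (Subfield.closure ({(β + lam * α ^ k) ^ N} : Set K)) := by
  classical
  have hp : p.Prime := Fact.out
  set F : Subfield K := Subfield.closure {α ^ N}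
  obtain ⟨r, hr, hcard⟩ := F.exists_natCard_eq_pow p
  by_contra! hsmall
  have hfix (l : K) (hl : l ∈ F) : ∃ d, 1 ≤ d ∧ d ≤ r ∧
      ((β + l * α ^ k) ^ N) ^ p ^ d = (β + l * α ^ k) ^ N := by
    obtain ⟨d, hd, hc⟩ :=
      (Subfield.closure {(β + l * α ^ k) ^ N} : Subfield K).exists_natCard_eq_pow p
    refine ⟨d, hd, ?_, ?_⟩
    · have := hsmall l hl
      rw [hcard, hc] at this
      exact (Nat.pow_le_pow_iff_right hp.one_lt).1 this
    · rw [← hc]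
      exact Subfield.pow_natCard _ (Subfield.subset_closure rfl)
  set A : Finset K := (Set.toFinite (F : Set K)).toFinset
  have hA (x : K) : x ∈ A ↔ x ∈ F := by simp [A]
  have hAcard : A.card = p ^ r := by
    exact (Set.ncard_eq_toFinset_card (F : Set K) (Set.toFinite _)).symm.trans hcard
  let S (d : ℕ) : Finset K :=
    A.filter fun l => ((β + l * α ^ k) ^ N) ^ p ^ d = (β + l * α ^ k) ^ N
  have hcover : A ⊆ S r ∪ (Finset.Ico 1 r).biUnion S := by
    intro l hl
    obtain ⟨d, hd, hdr, h⟩ := hfix l ((hA l).1 hl)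
    have hmem : l ∈ S d := Finset.mem_filter.2 ⟨hl, h⟩
    rcases hdr.eq_or_lt with rfl | hlt
    · exact Finset.mem_union_left _ hmem
    · exact Finset.mem_union_right _
        (Finset.mem_biUnion.2 ⟨d, Finset.mem_Ico.2 ⟨hd, hlt⟩, hmem⟩)
  have hbi : ((Finset.Ico 1 r).biUnion S).card ≤ ∑ d ∈ Finset.Ico 1 r, N * p ^ d :=
    Finset.card_biUnion_le.trans <| Finset.sum_le_sum fun d hd =>
      card_filter_affine_pow_le (pow_ne_zero k hα) (by omega)
        (Nat.one_lt_pow (by have := Finset.mem_Ico.1 hd; omega) hp.one_lt) A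
  have hS : N < (S r).card := by
    have h1 := (Finset.card_le_card hcover).trans (Finset.card_union_le _ _)
    have h2 := sum_Ico_pow_mul_lt hNp hr
    omega
  have hN0 : (N : K) ≠ 0 := fun h =>
    absurd (Nat.le_of_dvd (by omega) ((CharP.cast_eq_zero_iff K p N).1 h)) (by omega)
  have hfrobF (x : K) (hx : x ∈ F) : x ^ p ^ r = x := hcard ▸ F.pow_natCard hx
  obtain ⟨hb, hab⟩ := affine_pow_coeff_eq (a := α ^ k) (b := β) (a' := (α ^ k) ^ p ^ r)
    (b' := β ^ p ^ r) hN0 (S r) hS fun l hl => by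
      obtain ⟨hlA, h⟩ := Finset.mem_filter.1 hl
      rw [← h, pow_right_comm (β + l * α ^ k), add_pow_char_pow, mul_pow, hfrobF l ((hA l).1 hlA)]
  set L : Subfield K := Subfield.closure {α ^ N, β ^ N, α ^ k * β ^ (N - 1)}
  have hL : L ≤ (iterateFrobenius K p r).eqLocusField (RingHom.id K) := by
    refine Subfield.closure_le.2 ?_
    rintro x (rfl | rfl | rfl)
    · exact hfrobF _ (Subfield.subset_closure rfl)
    · change (β ^ N) ^ p ^ r = β ^ N
      rw [pow_right_comm, hb]
    · change (α ^ k * β ^ (N - 1)) ^ p ^ r = α ^ k * β ^ (N - 1)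
      rw [mul_pow, pow_right_comm β, hab]
  obtain ⟨hLfin, hLcard⟩ := natCard_le_of_pow_eq_self (Nat.one_lt_pow (by omega) hp.one_lt) L
    fun x hx => hL hx
  have hlt : Nat.card F < Nat.card L :=
    Set.ncard_lt_ncard (SetLike.coe_ssubset_coe.2 hproper) (Set.toFinite (L : Set K))
  omega

/-- Let `p` be a prime and `k, N` integers with `0 ≤ k < N < p`.
Let `α, β` be elements of the algebraic closure of `F_p` with `α ≠ 0`.
If `F_p(α^N)` is a proper subfield of `F_p(α^N, β^N, α^k·β^(N-1))`, then there exists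
`λ ∈ F_p(α^N)` such that the cardinality of `F_p((β + λ·α^k)^N)` is strictly greater than
the cardinality of `F_p(α^N)`.  Here `F_p(x, …)` is formalized as the subfield of the
algebraic closure generated by the given elements. -/
theorem stmt5 (p : ℕ) [Fact p.Prime] (k N : ℕ) (hkN : k < N) (hNp : N < p)
    (α β : AlgebraicClosure (ZMod p)) (hα : α ≠ 0)
    (hproper : Subfield.closure ({α ^ N} : Set (AlgebraicClosure (ZMod p))) <
      Subfield.closure ({α ^ N, β ^ N, α ^ k * β ^ (N - 1)} :
        Set (AlgebraicClosure (ZMod p)))) :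
    ∃ lam ∈ Subfield.closure ({α ^ N} : Set (AlgebraicClosure (ZMod p))),
      Nat.card (Subfield.closure ({α ^ N} : Set (AlgebraicClosure (ZMod p)))) <
        Nat.card (Subfield.closure ({(β + lam * α ^ k) ^ N} :
          Set (AlgebraicClosure (ZMod p)))) := by
  have : CharP (AlgebraicClosure (ZMod p)) p := charP_of_injective_algebraMap
    (algebraMap (ZMod p) (AlgebraicClosure (ZMod p))).injective p
  exact exists_natCard_closure_lt p (finite_closure_singleton p) k N hkN hNp α β hα hproper
end

section
/- Let p be an odd prime. The two permutations of the set F_p^7 ∖ {0} (of cardinality p^7 − 1) given by ρ(x_1,x_2,x_3,x_4,x_5,x_6,x_7) = (x_2,x_3,x_4,x_5,x_6,x_7,x_1) and γ(x_1,x_2,x_3,x_4,x_5,x_6,x_7) = (x_1 + x_2, x_2, x_3, x_4 + x_6², x_5, x_6, x_7) generate the full alternating group Alt(F_p^7 ∖ {0}). -/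
open Equiv

/-- The subgroup `H` contains the elementary map `v ↦ v + f(v) eᵢ`. -/
def HasShear {ι R : Type*} [DecidableEq ι] [AddCommGroup R] (H : Subgroup (Perm (ι → R))) (i : ι)
    (f : (ι → R) → R) : Prop :=
  ∃ g ∈ H, ∀ v, g v = v + Pi.single i (f v)

/-- The function `f` does not depend on the `i`-th coordinate. -/
def IndepOf {ι R : Type*} [DecidableEq ι] [AddCommGroup R] (f : (ι → R) → R) (i : ι) : Prop :=
  ∀ v c, f (v + Pi.single i c) = f v

section General

variable {ι R : Type*} [DecidableEq ι] [CommRing R] {H : Subgroup (Perm (ι → R))} {i j k : ι}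
  {f g : (ι → R) → R}

theorem IndepOf.const (c : R) : IndepOf (fun _ : ι → R => c) i := fun _ _ => rfl

theorem IndepOf.coord (h : j ≠ i) : IndepOf (fun v : ι → R => v j) i := by
  intro v c
  simp [Pi.single_eq_of_ne h]

theorem IndepOf.add (hf : IndepOf f i) (hg : IndepOf g i) : IndepOf (fun v => f v + g v) i :=
  fun v c => by simp only [hf v c, hg v c]

theorem IndepOf.mul (hf : IndepOf f i) (hg : IndepOf g i) : IndepOf (fun v => f v * g v) i :=
  fun v c => by simp only [hf v c, hg v c]

theorem IndepOf.pow (hf : IndepOf f i) (n : ℕ) : IndepOf (fun v => f v ^ n) i :=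
  fun v c => by simp only [hf v c]

theorem HasShear.congr (h : HasShear H i f) (e : ∀ v, f v = g v) : HasShear H i g := by
  rwa [← funext e]

theorem HasShear.zero : HasShear H i (fun _ => 0) := ⟨1, H.one_mem, fun v => by simp⟩

theorem HasShear.add (hf : HasShear H i f) (hg : HasShear H i g) (hi : IndepOf f i) :
    HasShear H i (fun v => f v + g v) := by
  obtain ⟨a, ha, ha'⟩ := hf
  obtain ⟨b, hb, hb'⟩ := hg
  refine ⟨a * b, H.mul_mem ha hb, fun v => ?_⟩
  simp only [Perm.mul_apply, hb', ha', hi _ _, Pi.single_add]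
  abel

theorem HasShear.neg (hf : HasShear H i f) (hi : IndepOf f i) :
    HasShear H i (fun v => -f v) := by
  obtain ⟨a, ha, ha'⟩ := hf
  refine ⟨a⁻¹, H.inv_mem ha, fun v => ?_⟩
  rw [Perm.inv_eq_iff_eq, ha', hi, Pi.single_neg, neg_add_cancel_right]

/-- The commutator of the shears along `f eᵢ` and `g eⱼ`. -/
theorem HasShear.commutator (hf : HasShear H i f) (hg : HasShear H j g)
    (hfj : IndepOf f j) (hgj : IndepOf g j) :
    HasShear H j (fun v => g (v + Pi.single i (f v)) - g v) := by
  obtain ⟨a, ha, ha'⟩ := hf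
  obtain ⟨b, hb, hb'⟩ := hg
  refine ⟨b⁻¹ * a⁻¹ * b * a, by
    exact H.mul_mem (H.mul_mem (H.mul_mem (H.inv_mem hb) (H.inv_mem ha)) hb) ha, fun v => ?_⟩
  simp only [Perm.mul_apply]
  rw [Perm.inv_eq_iff_eq, Perm.inv_eq_iff_eq]
  simp only [ha', hb', hgj _ _, hfj _ _]
  rw [Pi.single_sub]
  abel

/-- The commutator of the shears along `f eᵢ` and `xᵢ h eⱼ` is the shear along `f h eⱼ`. -/
theorem HasShear.substitute {h : (ι → R) → R} (hf : HasShear H i f)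
    (hg : HasShear H j (fun v => v i * h v)) (hij : i ≠ j)
    (hfj : IndepOf f j) (hhi : IndepOf h i) (hhj : IndepOf h j) :
    HasShear H j (fun v => f v * h v) := by
  refine (hf.commutator hg hfj ((IndepOf.coord hij).mul hhj)).congr fun v => ?_
  simp only [hhi _ _, Pi.add_apply, Pi.single_eq_same]
  ring

theorem HasShear.trans (hf : HasShear H i (fun v => v j)) (hg : HasShear H j f) (hij : i ≠ j)
    (hfi : IndepOf f i) : HasShear H i f :=
  (hg.substitute (h := fun _ => 1) (hf.congr fun _ => (mul_one _).symm) hij.symm hfi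
    (.const 1) (.const 1)).congr fun _ => mul_one _

theorem HasShear.natCast_mul (hf : HasShear H i f) (hi : IndepOf f i) (n : ℕ) :
    HasShear H i (fun v => n * f v) := by
  induction n with
  | zero => exact HasShear.zero.congr fun v => by simp
  | succ n ih => exact (hf.add ih hi).congr fun v => by push_cast; ring

theorem HasShear.clear_coords {K : Subgroup (Perm (ι → R))} {t : ι} {v : ι → R} (hv : v t = 1)
    (hK : ∀ i, i ≠ t → ∀ c : R, HasShear K i (fun v => c * v t)) (S : Finset ι) (hS : t ∉ S) :
    ∃ g ∈ K, ∀ k, g v k = if k ∈ S then 0 else v k := by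
  induction S using Finset.induction_on with
  | empty => exact ⟨1, K.one_mem, fun k => by simp⟩
  | insert a S ha ih =>
    simp only [Finset.mem_insert, not_or] at hS
    obtain ⟨g, hg, hgv⟩ := ih hS.2
    obtain ⟨b, hb, hbv⟩ := hK a (Ne.symm hS.1) (-v a)
    refine ⟨b * g, K.mul_mem hb hg, fun k => ?_⟩
    simp only [Perm.mul_apply, hbv, Pi.add_apply, hgv, if_neg hS.2, hv]
    by_cases hk : k = a
    · subst hk; simp [ha]
    · simp [hk]

end General

theorem HasShear.exists_map_eq_single {ι F : Type*} [DecidableEq ι] [Fintype ι] [Field F]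
    {K : Subgroup (Perm (ι → F))} {Z : Set ι}
    (hK : ∀ i j, i ≠ j → j ∉ Z → ∀ c : F, HasShear K i (fun v => c * v j))
    {s t j : ι} (hs : s ∉ Z) (ht : t ∉ Z) (hst : s ≠ t) (hj : j ∉ Z) {v : ι → F}
    (hv : v j ≠ 0) : ∃ g ∈ K, g v = Pi.single t 1 := by
  have away : ∃ g ∈ K, ∃ l, l ∉ Z ∧ l ≠ t ∧ g v l ≠ 0 := by
    by_cases hjt : j = t
    · subst hjt
      by_cases h0 : v s = 0
      · obtain ⟨g, hg, hgv⟩ := hK s j hst hj 1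
        exact ⟨g, hg, s, hs, hst, by simpa [hgv, h0] using hv⟩
      · exact ⟨1, K.one_mem, s, hs, hst, h0⟩
    · exact ⟨1, K.one_mem, j, hj, hjt, hv⟩
  obtain ⟨a, ha, l, hl, hlt, hal⟩ := away
  obtain ⟨b, hb, hbv⟩ := hK t l hlt.symm hl ((1 - a v t) / a v l)
  have hb1 : b (a v) t = 1 := by
    rw [hbv, Pi.add_apply, Pi.single_eq_same]
    field_simp
    ring
  obtain ⟨c, hc, hcv⟩ := HasShear.clear_coords hb1 (fun i hi => hK i t hi ht)
    (Finset.univ.erase t) (by simp)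
  refine ⟨c * b * a, K.mul_mem (K.mul_mem hc hb) ha, funext fun k => ?_⟩
  rw [Perm.mul_apply, Perm.mul_apply, hcv]
  by_cases hk : k = t
  · subst hk; simp [hb1]
  · simp [hk]

theorem Equiv.Perm.isThreeCycle_commutator {α : Type*} [Fintype α] [DecidableEq α]
    {σ τ : Perm α} {x : α} (hσ : σ x ≠ x) (hτ : τ x ≠ x)
    (h : ∀ y, σ y ≠ y → τ y ≠ y → y = x) : (σ * τ * σ⁻¹ * τ⁻¹).IsThreeCycle := by
  have h1 : τ (σ x) = σ x := by
    by_contra h1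
    exact hσ (h _ (fun e => hσ (σ.injective e)) h1)
  have h2 : σ (τ x) = τ x := by
    by_contra h2
    exact hτ (h _ h2 (fun e => hτ (τ.injective e)))
  have h3 : τ x ≠ σ x := fun e => hσ (σ.injective (e ▸ h2))
  suffices e : σ * τ * σ⁻¹ * τ⁻¹ = swap x (τ x) * swap x (σ x) by
    rw [e]
    exact isThreeCycle_swap_mul_swap_same hτ.symm hσ.symm h3
  rw [mul_inv_eq_iff_eq_mul, mul_inv_eq_iff_eq_mul]
  ext y
  simp only [Perm.mul_apply]
  by_cases hy : σ y = y
  · rw [hy]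
    by_cases hyx : τ y = x
    · rw [hyx, swap_apply_left, swap_apply_of_ne_of_ne hσ h3.symm]
    have hne : τ y ≠ σ x := fun e =>
      hσ (by rwa [τ.injective (e.trans h1.symm), σ.injective.eq_iff] at hy)
    have hne' : τ y ≠ τ x := fun e => hσ (by rwa [τ.injective e] at hy)
    rw [swap_apply_of_ne_of_ne hyx hne, swap_apply_of_ne_of_ne hyx hne']
    by_contra hc
    by_cases hty : τ y = y
    · exact hc (by rw [hty, hy])
    · exact hyx (h _ hc fun e => hty (τ.injective e))
  · have hty : y = x ∨ τ y = y := or_iff_not_imp_right.2 (h y hy)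
    rcases hty with rfl | hty
    · rw [h1, h2, swap_apply_right, swap_apply_left]
    rw [hty]
    by_cases hyx : σ y = x
    · rw [hyx, swap_apply_of_ne_of_ne hτ h3, swap_apply_right]
    have ht : τ (σ y) = σ y := by
      by_contra hc
      exact hyx (h _ (fun e => hy (σ.injective e)) hc)
    have hne : σ y ≠ σ x := fun e => hτ (by rwa [σ.injective e] at hty)
    have hne' : σ y ≠ τ x := fun e =>
      hτ (by rwa [σ.injective (e.trans h2.symm), τ.injective.eq_iff] at hty)
    rw [ht, swap_apply_of_ne_of_ne hyx hne, swap_apply_of_ne_of_ne hyx hne']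

section Seven

variable {p : ℕ} {ρ γ : Perm (Fin 7 → ZMod p)} {H : Subgroup (Perm (Fin 7 → ZMod p))}

open scoped Fin.NatCast in
theorem Fin.forall_of_add_one {n : ℕ} {P : Fin (n + 1) → Prop} {a : Fin (n + 1)} (h : P a)
    (hs : ∀ k, P k → P (k + 1)) (k : Fin (n + 1)) : P k := by
  have key : ∀ m : ℕ, P (a + (m : Fin (n + 1))) := fun m => by
    induction m with
    | zero => simpa using h
    | succ m ih =>
      rw [Nat.cast_succ, ← add_assoc]
      exact hs _ ih
  have := key (k - a).val
  rwa [Fin.cast_val_eq_self, add_sub_cancel] at this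

theorem HasShear.rotate {i : Fin 7} {f : (Fin 7 → ZMod p) → ZMod p} (hH : ρ ∈ H)
    (hρ : ∀ v (i : Fin 7), ρ v i = v (i + 1)) (hf : HasShear H i f) :
    HasShear H (i + 1) (fun v => f (ρ v)) := by
  obtain ⟨a, ha, ha'⟩ := hf
  refine ⟨ρ⁻¹ * a * ρ, H.mul_mem (H.mul_mem (H.inv_mem hH) ha) hH, fun v => ?_⟩
  simp only [Perm.mul_apply]
  rw [Perm.inv_eq_iff_eq, ha']
  ext k
  simp [hρ, Pi.single_apply]

theorem HasShear.rotate_all {d a : Fin 7} {q : ZMod p → ZMod p} (hH : ρ ∈ H)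
    (hρ : ∀ v (i : Fin 7), ρ v i = v (i + 1)) (hf : HasShear H a (fun v => q (v (a + d))))
    (i : Fin 7) : HasShear H i (fun v => q (v (i + d))) := by
  refine Fin.forall_of_add_one (P := fun i => HasShear H i (fun v => q (v (i + d)))) hf
    (fun k hk => (hk.rotate hH hρ).congr fun v => ?_) i
  rw [hρ, add_right_comm]

/-- The commutator of `γ` and its conjugate by `ρ` is a transvection. -/
theorem hasShear_zero_two (hρH : ρ ∈ H) (hγH : γ ∈ H)
    (hρ : ∀ v (i : Fin 7), ρ v i = v (i + 1))
    (hγ : ∀ v (i : Fin 7), γ v i =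
      if i = 0 then v 0 + v 1 else if i = 3 then v 3 + (v 5) ^ 2 else v i) :
    HasShear H 0 (fun v => v 2) := by
  obtain ⟨δ, hδH, hδ⟩ : ∃ δ ∈ H, ∀ v (i : Fin 7), δ v i =
      if i = 1 then v 1 + v 2 else if i = 4 then v 4 + (v 6) ^ 2 else v i := by
    refine ⟨ρ⁻¹ * γ * ρ, H.mul_mem (H.mul_mem (H.inv_mem hρH) hγH) hρH, fun v => ?_⟩
    rw [← funext_iff (g := fun i => _), Perm.mul_apply, Perm.mul_apply, Perm.inv_eq_iff_eq]
    ext i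
    rw [hρ, hγ]
    simp only [hρ]
    fin_cases i <;> simp
  refine ⟨(δ * γ)⁻¹ * (γ * δ),
    H.mul_mem (H.inv_mem (H.mul_mem hδH hγH)) (H.mul_mem hγH hδH), fun v => ?_⟩
  rw [Perm.mul_apply, Perm.inv_eq_iff_eq]
  ext i
  simp only [Perm.mul_apply, hγ, hδ, Pi.add_apply, Pi.single_apply]
  fin_cases i <;> simp
  ring

theorem hasShear_coord (hρH : ρ ∈ H) (hγH : γ ∈ H)
    (hρ : ∀ v (i : Fin 7), ρ v i = v (i + 1))
    (hγ : ∀ v (i : Fin 7), γ v i =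
      if i = 0 then v 0 + v 1 else if i = 3 then v 3 + (v 5) ^ 2 else v i)
    {i j : Fin 7} (hij : i ≠ j) : HasShear H i (fun v => v j) := by
  have h2 : ∀ i, HasShear H i (fun v => v (i + 2)) :=
    HasShear.rotate_all (q := id) hρH hρ (hasShear_zero_two hρH hγH hρ hγ)
  have step : ∀ d : Fin 7, d ≠ 0 → d + 2 ≠ 0 → (∀ i, HasShear H i (fun v => v (i + d))) →
      ∀ i, HasShear H i (fun v => v (i + (d + 2))) := fun d hd hd2 h i =>
    HasShear.trans (h i) (by simpa only [add_assoc] using h2 (i + d)) (by simpa using hd)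
      (IndepOf.coord (by simpa using hd2))
  have h4 := step 2 (by decide) (by decide) h2
  have h6 := step 4 (by decide) (by decide) h4
  have h1 := step 6 (by decide) (by decide) h6
  have h3 := step 1 (by decide) (by decide) h1
  have h5 := step 3 (by decide) (by decide) h3
  have key : ∀ d : Fin 7, d ≠ 0 → HasShear H i (fun v => v (i + d)) := by
    intro d hd
    fin_cases d
    · exact absurd rfl hd
    exacts [h1 i, h2 i, h3 i, h4 i, h5 i, h6 i]
  simpa using key (j - i) (sub_ne_zero.2 hij.symm)

theorem hasShear_sq (hρH : ρ ∈ H) (hγH : γ ∈ H)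
    (hρ : ∀ v (i : Fin 7), ρ v i = v (i + 1))
    (hγ : ∀ v (i : Fin 7), γ v i =
      if i = 0 then v 0 + v 1 else if i = 3 then v 3 + (v 5) ^ 2 else v i)
    {i j : Fin 7} (hij : i ≠ j) : HasShear H i (fun v => v j ^ 2) := by
  have h3 : HasShear H 3 (fun v => v (3 + 2) ^ 2) := by
    obtain ⟨a, ha, ha'⟩ := hasShear_coord hρH hγH hρ hγ (i := 0) (j := 1) (by decide)
    refine ⟨a⁻¹ * γ, H.mul_mem (H.inv_mem ha) hγH, fun v => ?_⟩
    rw [Perm.mul_apply, Perm.inv_eq_iff_eq, ha']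
    ext k
    rw [hγ]
    fin_cases k <;> simp
  have h := HasShear.rotate_all (q := fun x => x ^ 2) hρH hρ h3 (j - 2)
  rw [sub_add_cancel] at h
  by_cases hi : i = j - 2
  · rwa [hi]
  · exact (hasShear_coord hρH hγH hρ hγ hi).trans h hi ((IndepOf.coord hij.symm).pow 2)

variable [Fact p.Prime]

theorem HasShear.const_mul {ι : Type*} [DecidableEq ι] {H : Subgroup (Perm (ι → ZMod p))} {i : ι}
    {f : (ι → ZMod p) → ZMod p} (hf : HasShear H i f) (hi : IndepOf f i) (c : ZMod p) :
    HasShear H i (fun v => c * f v) := by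
  have := hf.natCast_mul hi c.val
  rwa [ZMod.natCast_zmod_val] at this

theorem hasShear_mul (hodd : Odd p) (hρH : ρ ∈ H) (hγH : γ ∈ H)
    (hρ : ∀ v (i : Fin 7), ρ v i = v (i + 1))
    (hγ : ∀ v (i : Fin 7), γ v i =
      if i = 0 then v 0 + v 1 else if i = 3 then v 3 + (v 5) ^ 2 else v i)
    {i j k : Fin 7} (hij : i ≠ j) (hik : i ≠ k) (hjk : j ≠ k) :
    HasShear H i (fun v => v j * v k) := by
  have h2 : (2 : ZMod p) ≠ 0 := by
    refine Ring.two_ne_zero ?_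
    rw [ZMod.ringChar_zmod_n]
    rintro rfl
    exact absurd hodd (by decide)
  have hj : IndepOf (fun v : Fin 7 → ZMod p => v j) i := .coord hij.symm
  have hk : IndepOf (fun v : Fin 7 → ZMod p => v k) i := .coord hik.symm
  have h := (hasShear_coord hρH hγH hρ hγ hjk).commutator (hasShear_sq hρH hγH hρ hγ hij)
    hk (hj.pow 2)
  have hneg := (hasShear_sq hρH hγH hρ hγ hik).neg (hk.pow 2)
  have h' : HasShear H i (fun v => 2 * (v j * v k)) :=
    (hneg.add h (fun v c => by simp only [hk v c])).congr fun v => by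
      simp only [Pi.add_apply, Pi.single_eq_same]
      ring
  refine (h'.const_mul ((IndepOf.const 2).mul (hj.mul hk)) 2⁻¹).congr fun v => ?_
  field_simp

end Seven

/-- The shears along `f eᵢ` and `f eⱼ` both lie in `H`, and `f` depends on neither `xᵢ` nor
`xⱼ`. -/
structure HasBiShear {ι R : Type*} [DecidableEq ι] [AddCommGroup R] (H : Subgroup (Perm (ι → R)))
    (i j : ι) (f : (ι → R) → R) : Prop where
  indep_left : IndepOf f i
  indep_right : IndepOf f j
  left : HasShear H i f
  right : HasShear H j f

namespace HasBiShear

variable {p : ℕ} [Fact p.Prime] {ι : Type*} [DecidableEq ι] {H : Subgroup (Perm (ι → ZMod p))}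
  {i j k : ι} {f g : (ι → ZMod p) → ZMod p}

theorem congr (h : HasBiShear H i j f) (e : ∀ v, f v = g v) : HasBiShear H i j g := by
  rwa [← funext e]

theorem add (hf : HasBiShear H i j f) (hg : HasBiShear H i j g) :
    HasBiShear H i j (fun v => f v + g v) :=
  ⟨hf.1.add hg.1, hf.2.add hg.2, hf.3.add hg.3 hf.1, hf.4.add hg.4 hf.2⟩

theorem const_mul (hf : HasBiShear H i j f) (c : ZMod p) :
    HasBiShear H i j (fun v => c * f v) :=
  ⟨(IndepOf.const c).mul hf.1, (IndepOf.const c).mul hf.2, hf.3.const_mul hf.1 c,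
    hf.4.const_mul hf.2 c⟩

theorem mul_coord
    (hH : ∀ i j k : ι, i ≠ j → i ≠ k → j ≠ k → HasShear H i (fun v => v j * v k))
    (hij : i ≠ j) (hki : k ≠ i) (hkj : k ≠ j) (hf : HasBiShear H i j f) :
    HasBiShear H i j (fun v => f v * v k) :=
  ⟨hf.1.mul (.coord hki), hf.2.mul (.coord hkj),
    hf.4.substitute (hH i j k hij hki.symm hkj.symm) hij.symm hf.1 (.coord hkj) (.coord hki),
    hf.3.substitute (hH j i k hij.symm hkj.symm hki.symm) hij hf.2 (.coord hki) (.coord hkj)⟩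

theorem mul_eval
    (hH : ∀ i j k : ι, i ≠ j → i ≠ k → j ≠ k → HasShear H i (fun v => v j * v k))
    (hij : i ≠ j) (hki : k ≠ i) (hkj : k ≠ j) (hf : HasBiShear H i j f)
    (q : Polynomial (ZMod p)) : HasBiShear H i j (fun v => f v * q.eval (v k)) := by
  induction q using Polynomial.induction_on' with
  | add q r hq hr => exact (hq.add hr).congr fun v => by rw [Polynomial.eval_add, mul_add]
  | monomial n c =>
    have hpow : HasBiShear H i j (fun v => f v * v k ^ n) := by
      induction n with
      | zero => exact hf.congr fun v => by simp
      | succ n ih => exact (ih.mul_coord hH hij hki hkj).congr fun v => by rw [pow_succ, mul_assoc]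
    exact (hpow.const_mul c).congr fun v => by rw [Polynomial.eval_monomial]; ring

theorem indicator
    (hH : ∀ i j k : ι, i ≠ j → i ≠ k → j ≠ k → HasShear H i (fun v => v j * v k))
    (hij : i ≠ j) (hki : k ≠ i) (hkj : k ≠ j) (hf : HasBiShear H i j f) :
    HasBiShear H i j (fun v => if v k = 1 then f v else 0) := by
  refine (hf.mul_eval hH hij hki hkj (1 - (Polynomial.X - 1) ^ (p - 1))).congr fun v => ?_
  have hp : p - 1 ≠ 0 := (Nat.sub_pos_of_lt (Fact.out : p.Prime).one_lt).ne'
  by_cases hv : v k = 1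
  · simp [hv, hp]
  · simp [hv, ZMod.pow_card_sub_one_eq_one (sub_ne_zero.2 hv)]

end HasBiShear

section Generation

variable {p : ℕ} [Fact p.Prime] {H : Subgroup (Perm (Fin 7 → ZMod p))}

theorem exists_isThreeCycle
    (hcoord : ∀ i j : Fin 7, i ≠ j → HasShear H i (fun v => v j))
    (hmul : ∀ i j k : Fin 7, i ≠ j → i ≠ k → j ≠ k → HasShear H i (fun v => v j * v k)) :
    ∃ g ∈ H, g.IsThreeCycle := by
  have base : ∀ i j k : Fin 7, k ≠ i → k ≠ j → HasBiShear H i j (fun v => v k) :=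
    fun i j k hki hkj => ⟨.coord hki, .coord hkj, hcoord i k hki.symm, hcoord j k hkj.symm⟩
  obtain ⟨σ, hσH, hσ⟩ := ((((base 0 4 1 (by decide) (by decide)).indicator (k := 1) hmul
    (by decide) (by decide) (by decide)).indicator (k := 2) hmul
    (by decide) (by decide) (by decide)).indicator (k := 3) hmul
    (by decide) (by decide) (by decide)).left
  obtain ⟨τ, hτH, hτ⟩ := (((((base 1 2 0 (by decide) (by decide)).indicator (k := 0) hmul
    (by decide) (by decide) (by decide)).indicator (k := 4) hmul
    (by decide) (by decide) (by decide)).indicator (k := 5) hmul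
    (by decide) (by decide) (by decide)).indicator (k := 6) hmul
    (by decide) (by decide) (by decide)).left
  refine ⟨σ * τ * σ⁻¹ * τ⁻¹, H.mul_mem (H.mul_mem (H.mul_mem hσH hτH) (H.inv_mem hσH))
    (H.inv_mem hτH), Perm.isThreeCycle_commutator (x := fun _ => 1) ?_ ?_ ?_⟩
  · simp [hσ]
  · simp [hτ]
  · intro y h1 h2
    rw [hσ, Ne, add_eq_left, Pi.single_eq_zero_iff] at h1
    rw [hτ, Ne, add_eq_left, Pi.single_eq_zero_iff] at h2
    simp only [ite_eq_right_iff, not_forall] at h1 h2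
    obtain ⟨h3, h2', h1', -⟩ := h1
    obtain ⟨h6, h5, h4, h0, -⟩ := h2
    ext i
    fin_cases i <;> assumption

theorem exists_map_eq_pair
    (hcoord : ∀ i j : Fin 7, i ≠ j → HasShear H i (fun v => v j))
    (hsq : ∀ i j : Fin 7, i ≠ j → HasShear H i (fun v => v j ^ 2))
    {a b : Fin 7 → ZMod p} (ha : a ≠ 0) (hb : b ≠ 0) (hab : a ≠ b) (h0 : ∀ g ∈ H, g 0 = 0) :
    ∃ g ∈ H, g a = Pi.single 0 1 ∧ g b = Pi.single 1 1 := by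
  have hlin : ∀ i j : Fin 7, i ≠ j → ∀ c : ZMod p, HasShear H i (fun v => c * v j) :=
    fun i j hij c => (hcoord i j hij).const_mul (.coord hij.symm) c
  obtain ⟨k, hk⟩ := Function.ne_iff.1 ha
  obtain ⟨g, hg, hga⟩ := HasShear.exists_map_eq_single (Z := ∅) (K := H)
    (fun i j hij _ c => hlin i j hij c) (s := 1) (t := 0) (j := k) (by simp) (by simp)
    (by decide) (by simp) hk
  set e : Fin 7 → ZMod p := Pi.single 0 1
  let K := H ⊓ MulAction.stabilizer (Perm (Fin 7 → ZMod p)) e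
  have hK : ∀ i f, HasShear H i f → f e = 0 → HasShear K i f := by
    rintro i f ⟨s, hs, hs'⟩ hf
    refine ⟨s, Subgroup.mem_inf.2 ⟨hs, ?_⟩, hs'⟩
    rw [MulAction.mem_stabilizer_iff, Perm.smul_def, hs', hf, Pi.single_zero,
      add_zero]
  have hgb : g b ≠ 0 := fun h => hb (g.injective (h.trans (h0 g hg).symm))
  have hgbe : g b ≠ e := fun h => hab (g.injective (hga.trans h.symm))
  have off : ∃ s ∈ K, ∃ l : Fin 7, l ≠ 0 ∧ s (g b) l ≠ 0 := by
    by_cases hl : ∃ l : Fin 7, l ≠ 0 ∧ g b l ≠ 0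
    · exact ⟨1, K.one_mem, hl⟩
    push Not at hl
    have hgbs : g b = Pi.single 0 (g b 0) := by
      ext l
      by_cases h : l = 0
      · subst h; simp
      · rw [hl l h, Pi.single_eq_of_ne h]
    have hc0 : g b 0 ≠ 0 := fun h => hgb (by rw [hgbs, h, Pi.single_zero])
    have hc1 : g b 0 ≠ 1 := fun h => hgbe (by rw [hgbs, h])
    have hquad : HasShear H 1 (fun v => v 0 ^ 2 + -1 * v 0) :=
      (hsq 1 0 (by decide)).add (hlin 1 0 (by decide) (-1)) ((IndepOf.coord (by decide)).pow 2)
    obtain ⟨s, hs, hs'⟩ := hK 1 _ hquad (by simp [e])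
    refine ⟨s, hs, 1, by decide, ?_⟩
    rw [hs', Pi.add_apply, hl 1 (by decide), Pi.single_eq_same, zero_add]
    simp only [show ∀ x : ZMod p, x ^ 2 + -1 * x = x * (x - 1) from fun x => by ring]
    exact mul_ne_zero hc0 (sub_ne_zero.2 hc1)
  obtain ⟨s, hs, l, hl, hsl⟩ := off
  obtain ⟨t, ht, htb⟩ := HasShear.exists_map_eq_single (Z := {0}) (K := K)
    (fun i j hij hj c => hK i _ (hlin i j hij c) (by simp [e, Pi.single_eq_of_ne hj]))
    (s := 2) (t := 1) (j := l) (by decide) (by decide) (by decide) hl hsl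
  have fix : ∀ x ∈ K, x e = e := fun x hx => hx.2
  exact ⟨t * s * g, H.mul_mem (H.mul_mem ht.1 hs.1) hg, by
    rw [Perm.mul_apply, Perm.mul_apply, hga, fix s hs, fix t ht], htb⟩

end Generation

theorem Equiv.Perm.sign_eq_one_of_pow_eq_one {α : Type*} [Fintype α] [DecidableEq α] {σ : Perm α}
    {n : ℕ} (hn : Odd n) (h : σ ^ n = 1) : sign σ = 1 := by
  have := congrArg sign h
  rw [map_pow, map_one] at this
  rcases Int.units_eq_one_or (sign σ) with h1 | h1
  · exact h1
  · rw [h1, hn.neg_one_pow] at this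
    exact absurd this (by decide)

theorem Equiv.Perm.mem_map_ofSubtype_alternatingGroup {α : Type*} [Fintype α] [DecidableEq α]
    {P : α → Prop} [DecidablePred P] {σ : Perm α} (h₁ : ∀ x, P (σ x) ↔ P x)
    (h₂ : ∀ x, σ x ≠ x → P x) (h : sign σ = 1) :
    σ ∈ (alternatingGroup (Subtype P)).map ofSubtype := by
  have e := ofSubtype_subtypePerm h₁ h₂
  exact ⟨σ.subtypePerm h₁, by
    rw [SetLike.mem_coe, mem_alternatingGroup, ← sign_ofSubtype, e, h], e⟩

/-- Let `p` be an odd prime.  The two permutations of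
`F_p^7 ∖ {0}` given by `ρ(x_1,…,x_7) = (x_2,…,x_7,x_1)` and
`γ(x_1,…,x_7) = (x_1+x_2, x_2, x_3, x_4+x_6², x_5, x_6, x_7)` generate the full
alternating group on `F_p^7 ∖ {0}`.
We realize `ρ, γ` as permutations of `F_p^7` fixing `0` (characterized by the displayed
formulas); the claim is then that the subgroup they generate equals the image of the
alternating group on `{v : F_p^7 // v ≠ 0}` under the embedding `ofSubtype`. -/
theorem stmt16 (p : ℕ) [Fact p.Prime] (hodd : Odd p)
    (ρ γ : Equiv.Perm (Fin 7 → ZMod p))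
    (hρ : ∀ v (i : Fin 7), ρ v i = v (i + 1))
    (hγ : ∀ v (i : Fin 7), γ v i =
      if i = 0 then v 0 + v 1 else if i = 3 then v 3 + (v 5) ^ 2 else v i) :
    Subgroup.closure {ρ, γ} =
      Subgroup.map Equiv.Perm.ofSubtype
        (alternatingGroup {v : Fin 7 → ZMod p // v ≠ 0}) := by
  have hρ0 : ρ 0 = 0 := by ext i; simp [hρ]
  have hγ0 : γ 0 = 0 := by ext i; simp [hγ]
  have ne_iff : ∀ σ : Perm (Fin 7 → ZMod p), σ 0 = 0 → ∀ v, σ v ≠ 0 ↔ v ≠ 0 := fun σ h v => by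
    rw [Ne, Ne, ← σ.injective.eq_iff (a := v), h]
  have ne_of : ∀ σ : Perm (Fin 7 → ZMod p), σ 0 = 0 → ∀ v, σ v ≠ v → v ≠ 0 := by
    rintro σ h _ hv rfl
    exact hv h
  apply le_antisymm
  · rw [Subgroup.closure_le]
    rintro σ (rfl | rfl)
    · refine Perm.mem_map_ofSubtype_alternatingGroup (ne_iff _ hρ0) (ne_of _ hρ0)
        (Perm.sign_eq_one_of_pow_eq_one (n := 7) (by decide) ?_)
      ext v i
      simp only [pow_succ, pow_zero, Perm.mul_apply, Perm.one_apply, hρ]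
      congr 1
      fin_cases i <;> rfl
    · refine Perm.mem_map_ofSubtype_alternatingGroup (ne_iff _ hγ0) (ne_of _ hγ0)
        (Perm.sign_eq_one_of_pow_eq_one hodd ?_)
      have hpow : ∀ (n : ℕ) v (i : Fin 7), (σ ^ n) v i = if i = 0 then v 0 + n * v 1 else
          if i = 3 then v 3 + n * (v 5) ^ 2 else v i := by
        intro n v i
        induction n generalizing i with
        | zero => simp; grind
        | succ n ih =>
          rw [pow_succ', Perm.mul_apply, hγ]
          simp only [ih]
          fin_cases i <;> simp <;> ring
      ext v i
      rw [hpow]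
      simp
      grind
  set H := Subgroup.closure {ρ, γ} with hH
  have hρH : ρ ∈ H := Subgroup.subset_closure (by simp)
  have hγH : γ ∈ H := Subgroup.subset_closure (by simp)
  have h0 : ∀ g ∈ H, g 0 = 0 := by
    have : H ≤ MulAction.stabilizer (Perm (Fin 7 → ZMod p)) (0 : Fin 7 → ZMod p) := by
      rw [hH, Subgroup.closure_le]
      rintro σ (rfl | rfl)
      exacts [hρ0, hγ0]
    exact fun g hg => this hg
  have hcoord := fun i j => hasShear_coord (i := i) (j := j) hρH hγH hρ hγ
  have hsq := fun i j => hasShear_sq (i := i) (j := j) hρH hγH hρ hγ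
  have hmul := fun i j k => hasShear_mul (i := i) (j := j) (k := k) hodd hρH hγH hρ hγ
  rw [Subgroup.map_le_iff_le_comap]
  have lift : ∀ g ∈ H, ∃ g' ∈ H.comap (Perm.ofSubtype (p := fun v : Fin 7 → ZMod p => v ≠ 0)),
      Perm.ofSubtype g' = g := fun g hg => by
    have e := Perm.ofSubtype_subtypePerm (ne_iff g (h0 g hg)) (ne_of g (h0 g hg))
    exact ⟨_, by rwa [Subgroup.mem_comap, e], e⟩
  obtain ⟨c, hc, hc3⟩ := exists_isThreeCycle hcoord hmul
  obtain ⟨c', hc', rfl⟩ := lift c hc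
  refine Perm.alternatingGroup_le_of_isPreprimitive_of_isThreeCycle_mem
    (MulAction.isPreprimitive_of_is_two_pretransitive (MulAction.is_two_pretransitive_iff.2 ?_))
    (g := c') (by rwa [Perm.IsThreeCycle, Perm.cycleType_ofSubtype] at hc3) hc'
  intro a b c d hab hcd
  obtain ⟨g, hg, hga, hgb⟩ :=
    exists_map_eq_pair hcoord hsq a.2 b.2 (Subtype.coe_ne_coe.2 hab) h0
  obtain ⟨k, hk, hkc, hkd⟩ :=
    exists_map_eq_pair hcoord hsq c.2 d.2 (Subtype.coe_ne_coe.2 hcd) h0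
  obtain ⟨m, hm, hm'⟩ := lift (k⁻¹ * g) (H.mul_mem (H.inv_mem hk) hg)
  refine ⟨⟨m, hm⟩, Subtype.ext ?_, Subtype.ext ?_⟩
  · rw [Subgroup.mk_smul, Perm.smul_def, ← Perm.ofSubtype_apply_coe, hm', Perm.mul_apply, hga,
      Perm.inv_eq_iff_eq, hkc]
  · rw [Subgroup.mk_smul, Perm.smul_def, ← Perm.ofSubtype_apply_coe, hm', Perm.mul_apply, hgb,
      Perm.inv_eq_iff_eq, hkd]
end
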